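/- Let P be a quasicontinuous domain. Define a binary relation ⊑ on finitely generated upper sets by ↑F ⊑ ↑G if and only if ↑F ⊆ int_{σ(P)}(↑G) (the Scott interior of ↑G). Then ⊑ is transitive and satisfies the interpolation property: whenever ↑F ⊑ ↑G for nonempty finite F, G ⊆ P, there exists a nonempty finite H ⊆ P such that ↑F ⊑ ↑H ⊑ ↑G. -/

import Mathlib

open Set

/-- The upper set `↑A` generated by a subset `A` of a preordered set. -/
def upSet {P : Type*} [Preorder P] (A : Set P) : Set P := {y | ∃ a ∈ A, a ≤ y}

/-- The lower set `↓A` generated by a subset `A` of a preordered set. -/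
def downSet {P : Type*} [Preorder P] (A : Set P) : Set P := {y | ∃ a ∈ A, y ≤ a}

/-- A poset is a dcpo if every (nonempty) directed subset has a least upper bound. -/
def IsDcpo (P : Type*) [Preorder P] : Prop :=
  ∀ D : Set P, D.Nonempty → DirectedOn (· ≤ ·) D → ∃ s, IsLUB D s

/-- A subset `U` is Scott open if it is an upper set and every directed set whose
supremum lies in `U` meets `U`. -/
def ScottOpen {P : Type*} [Preorder P] (U : Set P) : Prop :=
  IsUpperSet U ∧ ∀ D : Set P, ∀ s : P, D.Nonempty → DirectedOn (· ≤ ·) D →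
    IsLUB D s → s ∈ U → (D ∩ U).Nonempty

/-- The Scott topology `σ(P)`. -/
def scottT (P : Type*) [Preorder P] : TopologicalSpace P where
  IsOpen := ScottOpen
  isOpen_univ := ⟨isUpperSet_univ, fun D _ hD _ _ _ => hD.imp fun _ hd => ⟨hd, trivial⟩⟩
  isOpen_inter := by
    rintro U V ⟨hU, hU'⟩ ⟨hV, hV'⟩
    refine ⟨hU.inter hV, fun D s hD hdir hlub hs => ?_⟩
    obtain ⟨d₁, hd₁D, hd₁U⟩ := hU' D s hD hdir hlub hs.1
    obtain ⟨d₂, hd₂D, hd₂V⟩ := hV' D s hD hdir hlub hs.2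
    obtain ⟨d, hdD, h₁, h₂⟩ := hdir d₁ hd₁D d₂ hd₂D
    exact ⟨d, hdD, hU h₁ hd₁U, hV h₂ hd₂V⟩
  isOpen_sUnion := by
    intro S hS
    refine ⟨isUpperSet_sUnion fun U hU => (hS U hU).1, fun D s hD hdir hlub hs => ?_⟩
    obtain ⟨U, hUS, hsU⟩ := hs
    obtain ⟨d, hdD, hdU⟩ := (hS U hUS).2 D s hD hdir hlub hsU
    exact ⟨d, hdD, U, hUS, hdU⟩

/-- Scott interior. -/
def scottInt (P : Type*) [Preorder P] (A : Set P) : Set P := @interior P (scottT P) A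

/-- Scott closure. -/
def scottCl (P : Type*) [Preorder P] (A : Set P) : Set P := @closure P (scottT P) A

/-- The lower topology `ω(P)`, generated by the complements of principal upper sets. -/
def lowerT (P : Type*) [Preorder P] : TopologicalSpace P :=
  .generateFrom {V | ∃ x : P, V = (Ici x)ᶜ}

/-- The upper topology `υ(P)`, generated by the complements of principal lower sets. -/
def upperT (P : Type*) [Preorder P] : TopologicalSpace P :=
  .generateFrom {V | ∃ x : P, V = (Iic x)ᶜ}

/-- The Lawson topology `λ(P)`, generated by `σ(P) ∪ ω(P)`. -/
def lawsonT (P : Type*) [Preorder P] : TopologicalSpace P :=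
  .generateFrom ({U | ScottOpen U} ∪ {V | ∃ x : P, V = (Ici x)ᶜ})

/-- The interval topology `θ(P)`, generated by `ω(P) ∪ υ(P)`. -/
def intervalT (P : Type*) [Preorder P] : TopologicalSpace P :=
  .generateFrom ({V | ∃ x : P, V = (Ici x)ᶜ} ∪ {V | ∃ x : P, V = (Iic x)ᶜ})

/-- `A ≪ B`: for every directed set `D` with `sup D ∈ ↑B`, `D` meets `↑A`. -/
def WayBelowSet {P : Type*} [Preorder P] (A B : Set P) : Prop :=
  ∀ D : Set P, ∀ s : P, D.Nonempty → DirectedOn (· ≤ ·) D → IsLUB D s →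
    s ∈ upSet B → (D ∩ upSet A).Nonempty

/-- `u ≪ x`: every directed set `D` with `sup D ≥ x` contains some `d ≥ u`. -/
def WayBelowPt {P : Type*} [Preorder P] (u x : P) : Prop :=
  ∀ D : Set P, ∀ s : P, D.Nonempty → DirectedOn (· ≤ ·) D → IsLUB D s →
    x ≤ s → ∃ d ∈ D, u ≤ d

/-- A family of sets is filtered if it is (nonempty and) directed under reverse inclusion. -/
def Filtered {P : Type*} (𝒜 : Set (Set P)) : Prop :=
  𝒜.Nonempty ∧ ∀ S ∈ 𝒜, ∀ T ∈ 𝒜, ∃ R ∈ 𝒜, R ⊆ S ∧ R ⊆ T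

/-- The family `{↑F : F nonempty finite, F ≪ x}`. -/
def finWayFamily {P : Type*} [Preorder P] (x : P) : Set (Set P) :=
  {S | ∃ F : Set P, F.Nonempty ∧ F.Finite ∧ WayBelowSet F {x} ∧ S = upSet F}

/-- A quasicontinuous domain. -/
def IsQuasicontinuousDomain (P : Type*) [Preorder P] : Prop :=
  ∀ x : P, Filtered (finWayFamily x) ∧ Ici x = ⋂₀ finWayFamily x

/-- The family `{↑F : F nonempty finite, x ∈ ↑F, F ≪ F}`. -/
def finCompactFamily {P : Type*} [Preorder P] (x : P) : Set (Set P) :=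
  {S | ∃ F : Set P, F.Nonempty ∧ F.Finite ∧ x ∈ upSet F ∧ WayBelowSet F F ∧ S = upSet F}

/-- A quasialgebraic domain. -/
def IsQuasialgebraicDomain (P : Type*) [Preorder P] : Prop :=
  ∀ x : P, Filtered (finCompactFamily x) ∧ Ici x = ⋂₀ finCompactFamily x

/-- A continuous domain: every `⇓x` is directed (hence nonempty) with supremum `x`. -/
def IsContinuousDomain (P : Type*) [Preorder P] : Prop :=
  ∀ x : P, {u | WayBelowPt u x}.Nonempty ∧ DirectedOn (· ≤ ·) {u | WayBelowPt u x} ∧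
    IsLUB {u | WayBelowPt u x} x

/-- The set `K(P)` of compact elements. -/
def compacts (P : Type*) [Preorder P] : Set P := {k | WayBelowPt k k}

/-- An algebraic domain. -/
def IsAlgebraicDomain (P : Type*) [Preorder P] : Prop :=
  ∀ x : P, (compacts P ∩ Iic x).Nonempty ∧ DirectedOn (· ≤ ·) (compacts P ∩ Iic x) ∧
    IsLUB (compacts P ∩ Iic x) x

/-- A meet-continuous dcpo: whenever `x ≤ sup D` for a directed set `D`,
`x` lies in the Scott closure of `↓x ∩ ↓D`. -/
def MeetContinuous (P : Type*) [Preorder P] : Prop :=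
  ∀ x : P, ∀ D : Set P, ∀ s : P, D.Nonempty → DirectedOn (· ≤ ·) D → IsLUB D s → x ≤ s →
    x ∈ scottCl P (Iic x ∩ downSet D)

/-- The set of dyadic rationals in `[0,1]`. -/
def dyadics : Set ℝ := {t | ∃ m n : ℕ, m ≤ 2 ^ n ∧ t = (m : ℝ) / 2 ^ n}

theorem subset_upSet {P : Type*} [Preorder P] (A : Set P) : A ⊆ upSet A :=
  fun a ha => ⟨a, ha, le_rfl⟩

theorem isUpperSet_upSet {P : Type*} [Preorder P] (A : Set P) : IsUpperSet (upSet A) :=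
  fun _ _ hxy ⟨a, ha, hax⟩ => ⟨a, ha, hax.trans hxy⟩

theorem upSet_mono {P : Type*} [Preorder P] {A B : Set P} (h : A ⊆ B) : upSet A ⊆ upSet B :=
  fun _ ⟨a, ha, hax⟩ => ⟨a, h ha, hax⟩

theorem upSet_subset_iff {P : Type*} [Preorder P] {A U : Set P} (hU : IsUpperSet U) :
    upSet A ⊆ U ↔ A ⊆ U :=
  ⟨(subset_upSet A).trans, fun h _ ⟨_, ha, hax⟩ => hU hax (h ha)⟩

theorem scottInt_subset {P : Type*} [Preorder P] (A : Set P) : scottInt P A ⊆ A :=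
  @interior_subset P (scottT P) A

theorem scottOpen_scottInt {P : Type*} [Preorder P] (A : Set P) : ScottOpen (scottInt P A) :=
  @isOpen_interior P (scottT P) A

theorem ScottOpen.subset_scottInt {P : Type*} [Preorder P] {U A : Set P} (hU : ScottOpen U)
    (h : U ⊆ A) : U ⊆ scottInt P A :=
  @interior_maximal P (scottT P) A U h hU

theorem scottInt_mono {P : Type*} [Preorder P] {A B : Set P} (h : A ⊆ B) :
    scottInt P A ⊆ scottInt P B :=
  @interior_mono P (scottT P) A B h

/-- A finite set meeting every member of a nonempty chain of sets meets its intersection. -/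
theorem IsChain.inter_sInter_nonempty_of_finite {α : Type*} {c : Set (Set α)}
    (hc : IsChain (· ⊆ ·) c) (hne : c.Nonempty) {F : Set α} (hF : F.Finite)
    (h : ∀ A ∈ c, (A ∩ F).Nonempty) : (⋂₀ c ∩ F).Nonempty := by
  by_contra hcon
  have hmiss : ∀ f ∈ F, ∃ A ∈ c, f ∉ A := by
    intro f hf
    by_contra! hall
    exact hcon ⟨f, hall, hf⟩
  have key : ∃ A ∈ c, ∀ f ∈ F, f ∉ A := by
    clear h hcon
    induction F, hF using Set.Finite.induction_on with
    | empty => exact hne.imp fun A hA => ⟨hA, by simp⟩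
    | @insert a s _ _ ih =>
      obtain ⟨A, hA, hAs⟩ := ih fun f hf => hmiss f (mem_insert_of_mem a hf)
      obtain ⟨B, hB, haB⟩ := hmiss a (mem_insert a s)
      rcases hc.total hA hB with hAB | hBA
      · exact ⟨A, hA, forall_mem_insert.2 ⟨fun ha => haB (hAB ha), hAs⟩⟩
      · exact ⟨B, hB, forall_mem_insert.2 ⟨haB, fun f hf hfB => hAs f hf (hBA hfB)⟩⟩
  obtain ⟨A, hA, hAF⟩ := key
  obtain ⟨f, hfA, hfF⟩ := h A hA
  exact hAF f hfF hfA

/-- A form of Rudin's lemma: a filtered family of finitely generated upper sets has a member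
inside the upper set `U` as soon as every directed set whose supremum lies in the intersection
of the family meets `U`. -/
theorem Filtered.exists_subset_of_directedOn {P : Type*} [Preorder P] (hdcpo : IsDcpo P)
    {𝒜 : Set (Set P)} (h𝒜 : Filtered 𝒜) (hfin : ∀ K ∈ 𝒜, ∃ F : Set P, F.Finite ∧ K = upSet F)
    {U : Set P} (hU : IsUpperSet U)
    (hmeet : ∀ D : Set P, ∀ s : P, D.Nonempty → DirectedOn (· ≤ ·) D → IsLUB D s →
      s ∈ ⋂₀ 𝒜 → (D ∩ U).Nonempty) :
    ∃ K ∈ 𝒜, K ⊆ U := by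
  by_contra! hcon
  let S : Set (Set P) := {A | IsLowerSet A ∧ A ⊆ Uᶜ ∧ ∀ K ∈ 𝒜, (A ∩ K).Nonempty}
  have hS : ∃ m, Minimal (· ∈ S) m := by
    refine zorn_superset S fun c hcS hc => ?_
    rcases c.eq_empty_or_nonempty with rfl | hne
    · refine ⟨Uᶜ, ⟨hU.compl, Subset.rfl, fun K hK => ?_⟩, by simp⟩
      obtain ⟨x, hxK, hxU⟩ := not_subset.1 (hcon K hK)
      exact ⟨x, hxU, hxK⟩
    · refine ⟨⋂₀ c, ⟨isLowerSet_sInter fun A hA => (hcS hA).1, ?_, fun K hK => ?_⟩,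
        fun A hA => sInter_subset_of_mem hA⟩
      · obtain ⟨A, hA⟩ := hne
        exact (sInter_subset_of_mem hA).trans (hcS hA).2.1
      · obtain ⟨F, hF, rfl⟩ := hfin K hK
        refine (hc.inter_sInter_nonempty_of_finite hne hF fun A hA => ?_).mono
          (inter_subset_inter_right _ (subset_upSet F))
        obtain ⟨x, hxA, f, hf, hfx⟩ := (hcS hA).2.2 _ hK
        exact ⟨f, (hcS hA).1 hfx hxA, hf⟩
  obtain ⟨A, ⟨hAlow, hAU, hAmeet⟩, hmin⟩ := hS
  have hmiss : ∀ x ∈ A, ∃ K ∈ 𝒜, ∀ z ∈ A, z ∈ K → x ≤ z := by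
    intro x hx
    by_contra! h
    have hmem : A \ Ici x ∈ S := by
      refine ⟨fun a b hba ha => ⟨hAlow hba ha.1, fun hb => ha.2 (le_trans hb hba)⟩,
        sdiff_subset.trans hAU, fun K hK => ?_⟩
      obtain ⟨z, hzA, hzK, hxz⟩ := h K hK
      exact ⟨z, ⟨hzA, hxz⟩, hzK⟩
    exact (hmin hmem sdiff_subset hx).2 le_rfl
  have hdir : DirectedOn (· ≤ ·) A := by
    intro x hx y hy
    obtain ⟨K, hK, hKx⟩ := hmiss x hx
    obtain ⟨L, hL, hLy⟩ := hmiss y hy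
    obtain ⟨R, hR, hRK, hRL⟩ := h𝒜.2 K hK L hL
    obtain ⟨z, hzA, hzR⟩ := hAmeet R hR
    exact ⟨z, hzA, hKx z hzA (hRK hzR), hLy z hzA (hRL hzR)⟩
  have hne : A.Nonempty := by
    obtain ⟨K, hK⟩ := h𝒜.1
    exact (hAmeet K hK).left
  obtain ⟨s, hs⟩ := hdcpo A hne hdir
  obtain ⟨x, hxA, hxU⟩ := hmeet A s hne hdir hs fun K hK => by
    obtain ⟨z, hzA, hzK⟩ := hAmeet K hK
    obtain ⟨F, -, rfl⟩ := hfin K hK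
    exact isUpperSet_upSet F (hs.1 hzA) hzK
  exact hAU hxA hxU

theorem exists_finite_eq_upSet_of_mem_finWayFamily {P : Type*} [Preorder P] {x : P} {K : Set P}
    (hK : K ∈ finWayFamily x) : ∃ F : Set P, F.Finite ∧ K = upSet F := by
  obtain ⟨F, -, hF, -, rfl⟩ := hK
  exact ⟨F, hF, rfl⟩

theorem WayBelowSet.mono {P : Type*} [Preorder P] {A A' B B' : Set P} (h : WayBelowSet A B)
    (hA : upSet A ⊆ upSet A') (hB : upSet B' ⊆ upSet B) : WayBelowSet A' B' :=
  fun D s hD hdir hs hsB => (h D s hD hdir hs (hB hsB)).mono (inter_subset_inter_right _ hA)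

theorem upSet_singleton {P : Type*} [Preorder P] (x : P) : upSet {x} = Ici x := by
  ext y
  simp [upSet]

theorem WayBelowSet.mem_upSet {P : Type*} [Preorder P] {A : Set P} {x : P}
    (h : WayBelowSet A {x}) : x ∈ upSet A := by
  obtain ⟨y, rfl, hy⟩ := h {x} x (singleton_nonempty x) (directedOn_singleton x)
    isLUB_singleton (subset_upSet _ rfl)
  exact hy

theorem finWayFamily_mono {P : Type*} [Preorder P] {x y : P} (h : x ≤ y) :
    finWayFamily x ⊆ finWayFamily y := by
  rintro K ⟨F, hne, hF, hFx, rfl⟩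
  refine ⟨F, hne, hF, hFx.mono Subset.rfl ?_, rfl⟩
  simpa [upSet_singleton] using h

/-- In a quasicontinuous domain the set of points that `F` is way below is Scott open. -/
theorem IsQuasicontinuousDomain.scottOpen_wayBelowSet {P : Type*} [Preorder P]
    (hdcpo : IsDcpo P) (hqc : IsQuasicontinuousDomain P) (F : Set P) :
    ScottOpen {x | WayBelowSet F {x}} := by
  refine ⟨fun x y hxy hx => hx.mono Subset.rfl (by simpa [upSet_singleton] using hxy),
    fun D s hD hdir hs hFs => ?_⟩
  have hfilt : Filtered (⋃ d ∈ D, finWayFamily d) := by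
    refine ⟨?_, ?_⟩
    · obtain ⟨d, hd⟩ := hD
      obtain ⟨K, hK⟩ := (hqc d).1.1
      exact ⟨K, mem_biUnion hd hK⟩
    · intro K hK L hL
      obtain ⟨a, ha, hKa⟩ := mem_iUnion₂.1 hK
      obtain ⟨b, hb, hLb⟩ := mem_iUnion₂.1 hL
      obtain ⟨d, hd, had, hbd⟩ := hdir a ha b hb
      obtain ⟨R, hR, hRKL⟩ :=
        (hqc d).1.2 K (finWayFamily_mono had hKa) L (finWayFamily_mono hbd hLb)
      exact ⟨R, mem_biUnion hd hR, hRKL⟩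
  obtain ⟨K, hK, hKF⟩ := hfilt.exists_subset_of_directedOn hdcpo
    (fun K hK => by
      obtain ⟨d, -, hKd⟩ := mem_iUnion₂.1 hK
      exact exists_finite_eq_upSet_of_mem_finWayFamily hKd)
    (isUpperSet_upSet F) (fun E t hE hEdir ht htmem => by
      refine hFs E t hE hEdir ht ?_
      rw [upSet_singleton]
      refine hs.2 fun d hd => ?_
      change t ∈ Ici d
      rw [(hqc d).2]
      exact fun K hK => htmem K (mem_biUnion hd hK))
  obtain ⟨d, hd, G, -, -, hGd, rfl⟩ := mem_iUnion₂.1 hK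
  exact ⟨d, hd, hGd.mono hKF Subset.rfl⟩

theorem IsQuasicontinuousDomain.mem_scottInt_of_wayBelowSet {P : Type*} [Preorder P]
    (hdcpo : IsDcpo P) (hqc : IsQuasicontinuousDomain P) {F : Set P} {x : P}
    (h : WayBelowSet F {x}) : x ∈ scottInt P (upSet F) :=
  (hqc.scottOpen_wayBelowSet hdcpo F).subset_scottInt (fun _ hy => hy.mem_upSet) h

theorem IsQuasicontinuousDomain.exists_wayBelowSet_subset {P : Type*} [Preorder P]
    (hdcpo : IsDcpo P) (hqc : IsQuasicontinuousDomain P) {U : Set P} (hU : ScottOpen U) {x : P}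
    (hx : x ∈ U) :
    ∃ H : Set P, H.Nonempty ∧ H.Finite ∧ WayBelowSet H {x} ∧ upSet H ⊆ U := by
  obtain ⟨K, ⟨H, hne, hH, hHx, rfl⟩, hKU⟩ := (hqc x).1.exists_subset_of_directedOn hdcpo
    (fun _ => exists_finite_eq_upSet_of_mem_finWayFamily) hU.1 (fun D s hD hdir hs hsmem => by
      rw [← (hqc x).2] at hsmem
      exact hU.2 D s hD hdir hs (hU.1 hsmem hx))
  exact ⟨H, hne, hH, hHx, hKU⟩

/-- In a quasicontinuous domain, the relation `↑F ⊑ ↑G ↔ ↑F ⊆ int_σ(↑G)` on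
finitely generated upper sets is transitive and satisfies the interpolation property. -/
theorem quasicontinuous_rel_transitive_and_interpolation
    (P : Type*) [PartialOrder P] (hdcpo : IsDcpo P) (hqc : IsQuasicontinuousDomain P) :
    (∀ F G H : Set P, F.Nonempty → F.Finite → G.Nonempty → G.Finite → H.Nonempty → H.Finite →
      upSet F ⊆ scottInt P (upSet G) → upSet G ⊆ scottInt P (upSet H) →
        upSet F ⊆ scottInt P (upSet H)) ∧
    (∀ F G : Set P, F.Nonempty → F.Finite → G.Nonempty → G.Finite →
      upSet F ⊆ scottInt P (upSet G) →
        ∃ H : Set P, H.Nonempty ∧ H.Finite ∧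
          upSet F ⊆ scottInt P (upSet H) ∧ upSet H ⊆ scottInt P (upSet G)) := by
  refine ⟨fun F G H _ _ _ _ _ _ hFG hGH => (hFG.trans (scottInt_subset _)).trans hGH,
    fun F G hFne hF _ _ hFG => ?_⟩
  have hpt : ∀ f ∈ F, ∃ H : Set P, H.Nonempty ∧ H.Finite ∧ WayBelowSet H {f} ∧
      upSet H ⊆ scottInt P (upSet G) := fun f hf =>
    hqc.exists_wayBelowSet_subset hdcpo (scottOpen_scottInt _) (hFG (subset_upSet F hf))
  choose! H hHne hHfin hHf hHG using hpt
  refine ⟨⋃ f ∈ F, H f, ?_, hF.biUnion hHfin, ?_, ?_⟩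
  · obtain ⟨f, hf⟩ := hFne
    exact (hHne f hf).mono (subset_biUnion_of_mem hf)
  · rw [upSet_subset_iff (scottOpen_scottInt _).1]
    exact fun f hf => scottInt_mono (upSet_mono (subset_biUnion_of_mem hf))
      (hqc.mem_scottInt_of_wayBelowSet hdcpo (hHf f hf))
  · rw [upSet_subset_iff (scottOpen_scottInt _).1]
    exact iUnion₂_subset fun f hf => (subset_upSet _).trans (hHG f hf)
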